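/- Let X₀ ∈ K^{n×l} be row k-sparse with support Ω, let Γ ⊆ {1,…,n}, and let S̄ be an r-dimensional subspace of R(Φ_Ω X₀^Ω). Then for every i ∈ {1,…,n} \ (Ω ∪ Γ) one has ‖P_{R(P^⊥_{R(Φ_Γ)} S̄)} φ̇_i‖₂ ≤ √( 1 − σ²_{|{i} ∪ Ω \ Γ|}(Φ̇_{{i} ∪ Ω \ Γ}) ), i.e., the squared norm of the projection of φ̇_i onto the projected signal subspace is at most 1 minus the smallest squared singular value of the matrix Φ̇ restricted to the columns indexed by {i} ∪ (Ω \ Γ). -/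

import Mathlib

open scoped Matrix

noncomputable section

variable {𝕜 : Type*} [RCLike 𝕜]

/-- The `i`-th largest singular value (1-indexed) of a matrix, via the
Courant–Fischer max–min characterization. -/
def sval {m n : ℕ} (A : Matrix (Fin m) (Fin n) 𝕜) (i : ℕ) : ℝ :=
  sSup { t : ℝ | 0 ≤ t ∧ ∃ S : Submodule 𝕜 (EuclideanSpace 𝕜 (Fin n)),
    Module.finrank 𝕜 S = i ∧ ∀ x ∈ S, t * ‖x‖ ≤ ‖Matrix.toEuclideanLin A x‖ }

/-- Submatrix of columns indexed by the finset `J` (in increasing order). -/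
def colSub {m n : ℕ} (A : Matrix (Fin m) (Fin n) 𝕜) (J : Finset (Fin n)) :
    Matrix (Fin m) (Fin J.card) 𝕜 :=
  A.submatrix id (fun j => J.orderEmbOfFin rfl j)

/-- Submatrix of rows indexed by the finset `J` (in increasing order). -/
def rowSub {m n : ℕ} (A : Matrix (Fin m) (Fin n) 𝕜) (J : Finset (Fin m)) :
    Matrix (Fin J.card) (Fin n) 𝕜 :=
  A.submatrix (fun i => J.orderEmbOfFin rfl i) id

/-- Moore–Penrose pseudoinverse (valid formula in the full-column-rank case,
which holds in every statement where it is used). -/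
def pinv {m n : ℕ} (A : Matrix (Fin m) (Fin n) 𝕜) : Matrix (Fin n) (Fin m) 𝕜 :=
  (Aᴴ * A)⁻¹ * Aᴴ

open Classical in
/-- The set of indices of nonzero rows of a matrix. -/
def rowSupport {n l : ℕ} (X : Matrix (Fin n) (Fin l) 𝕜) : Finset (Fin n) :=
  Finset.univ.filter (fun i => X i ≠ 0)

/-- Column space (range) of a matrix, as a submodule of Euclidean space. -/
def mrange {m : ℕ} {ι : Type*} [Fintype ι] [DecidableEq ι]
    (A : Matrix (Fin m) ι 𝕜) : Submodule 𝕜 (EuclideanSpace 𝕜 (Fin m)) :=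
  LinearMap.range (Matrix.toEuclideanLin A)

/-- Orthogonal projection onto a subspace, as an endomorphism. -/
def proj {m : ℕ} (S : Submodule 𝕜 (EuclideanSpace 𝕜 (Fin m))) :
    EuclideanSpace 𝕜 (Fin m) →L[𝕜] EuclideanSpace 𝕜 (Fin m) :=
  S.subtypeL.comp S.orthogonalProjectionOnto

/-- The `i`-th column of a matrix, as an element of Euclidean space. -/
def col {m n : ℕ} (A : Matrix (Fin m) (Fin n) 𝕜) (i : Fin n) :
    EuclideanSpace 𝕜 (Fin m) :=
  (WithLp.equiv 2 (Fin m → 𝕜)).symm (fun r => A r i)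

/-- The normalized projection `φ̇_i` of the `i`-th column of `Φ` onto the
orthogonal complement of the range of `Φ_Γ` (zero if the projection vanishes). -/
def ndot {m n : ℕ} (Φ : Matrix (Fin m) (Fin n) 𝕜) (Γ : Finset (Fin n)) (i : Fin n) :
    EuclideanSpace 𝕜 (Fin m) :=
  ‖proj (mrange (colSub Φ Γ))ᗮ (col Φ i)‖⁻¹ • proj (mrange (colSub Φ Γ))ᗮ (col Φ i)

/-- The matrix `Φ̇_J` whose columns are the `φ̇_i`, `i ∈ J`. -/
def ndotMat {m n : ℕ} (Φ : Matrix (Fin m) (Fin n) 𝕜) (Γ J : Finset (Fin n)) :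
    Matrix (Fin m) (Fin J.card) 𝕜 :=
  fun r j => ndot Φ Γ (J.orderEmbOfFin rfl j) r

/-- Kruskal rank: the maximal `q` such that every `q` columns are linearly
independent. -/
def krank {ρ ι : Type*} [Fintype ι] (A : Matrix ρ ι 𝕜) : ℕ :=
  sSup {q : ℕ | q ≤ Fintype.card ι ∧ ∀ J : Finset ι, J.card = q →
    LinearIndependent 𝕜 (fun j : J => Aᵀ j.1)}

/-- `X` is row-nondegenerate if `krank (Xᴴ) = rank X`. -/
def rowNondegenerate {n l : ℕ} (X : Matrix (Fin n) (Fin l) 𝕜) : Prop :=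
  krank Xᴴ = X.rank

/-- ℓ₂ norm of the `i`-th row of a matrix. -/
def rowNorm {n l : ℕ} (A : Matrix (Fin n) (Fin l) 𝕜) (i : Fin n) : ℝ :=
  Real.sqrt (∑ j, ‖A i j‖ ^ 2)


theorem aux_toLin_apply {𝕜 : Type*} [RCLike 𝕜] {m n : ℕ} (A : Matrix (Fin m) (Fin n) 𝕜)
    (x : EuclideanSpace 𝕜 (Fin n)) :
    Matrix.toEuclideanLin A x = ∑ j, x j • col A j := by
  ext r
  simp [Matrix.toLpLin_apply, Matrix.mulVec, dotProduct, col, mul_comm]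

theorem aux_toLin_single {𝕜 : Type*} [RCLike 𝕜] {m n : ℕ} (A : Matrix (Fin m) (Fin n) 𝕜)
    (j : Fin n) :
    Matrix.toEuclideanLin A (EuclideanSpace.single j 1) = col A j := by
  ext r
  simp [Matrix.toLpLin_apply, col]

theorem aux_col_ndotMat {𝕜 : Type*} [RCLike 𝕜] {m n : ℕ} (Φ : Matrix (Fin m) (Fin n) 𝕜)
    (Γ J : Finset (Fin n)) (j : Fin J.card) :
    col (ndotMat Φ Γ J) j = ndot Φ Γ (J.orderEmbOfFin rfl j) := by
  ext r
  simp [col, ndotMat]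

theorem aux_emb {n : ℕ} (J : Finset (Fin n)) {a : Fin n} (ha : a ∈ J) :
    ∃ j, J.orderEmbOfFin rfl j = a := by
  have h : a ∈ Set.range (J.orderEmbOfFin rfl) := by
    rw [Finset.range_orderEmbOfFin]; exact ha
  exact h

theorem aux_proj_col_zero {𝕜 : Type*} [RCLike 𝕜] {m n : ℕ} (Φ : Matrix (Fin m) (Fin n) 𝕜)
    (Γ : Finset (Fin n)) {a : Fin n} (ha : a ∈ Γ) :
    proj (mrange (colSub Φ Γ))ᗮ (col Φ a) = 0 := by
  have h : col Φ a ∈ mrange (colSub Φ Γ) := by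
    obtain ⟨j, hj⟩ := aux_emb Γ ha
    refine ⟨EuclideanSpace.single j 1, ?_⟩
    rw [aux_toLin_single]
    ext r
    simp [col, colSub, hj]
  have h2 : (mrange (colSub Φ Γ))ᗮ.orthogonalProjectionOnto (col Φ a) = 0 := by
    rw [Submodule.orthogonalProjectionOnto_eq_zero_iff]
    exact Submodule.le_orthogonal_orthogonal _ h
  simp [proj, h2]

theorem aux_norm_ndot_le {𝕜 : Type*} [RCLike 𝕜] {m n : ℕ} (Φ : Matrix (Fin m) (Fin n) 𝕜)
    (Γ : Finset (Fin n)) (i : Fin n) : ‖ndot Φ Γ i‖ ≤ 1 := by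
  unfold ndot
  rw [norm_smul, norm_inv, norm_norm]
  exact inv_mul_le_one

theorem aux_proj_col {𝕜 : Type*} [RCLike 𝕜] {m n : ℕ} (Φ : Matrix (Fin m) (Fin n) 𝕜)
    (Γ : Finset (Fin n)) (a : Fin n) :
    proj (mrange (colSub Φ Γ))ᗮ (col Φ a) =
      ((‖proj (mrange (colSub Φ Γ))ᗮ (col Φ a)‖ : ℝ) : 𝕜) • ndot Φ Γ a := by
  unfold ndot
  generalize proj (mrange (colSub Φ Γ))ᗮ (col Φ a) = v
  by_cases hv : v = 0
  · simp [hv]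
  · have hv' : ‖v‖ ≠ 0 := norm_ne_zero_iff.mpr hv
    have h : ((‖v‖ : ℝ) : 𝕜) • ‖v‖⁻¹ • v = ‖v‖ • ‖v‖⁻¹ • v := by
      ext r
      simp [RCLike.real_smul_eq_coe_mul]
    rw [h, smul_smul, mul_inv_cancel₀ hv', one_smul]

theorem aux_mem {𝕜 : Type*} [RCLike 𝕜] {m n l : ℕ} (Φ : Matrix (Fin m) (Fin n) 𝕜)
    (X₀ : Matrix (Fin n) (Fin l) 𝕜) (Ω Γ : Finset (Fin n))
    (Sbar : Submodule 𝕜 (EuclideanSpace 𝕜 (Fin m)))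
    (hS : Sbar ≤ mrange (colSub Φ Ω * rowSub X₀ Ω)) (i : Fin n) (hi : i ∉ Ω)
    (i0 : Fin (insert i (Ω \ Γ)).card)
    (hi0 : (insert i (Ω \ Γ)).orderEmbOfFin rfl i0 = i) :
    Sbar.map (proj (mrange (colSub Φ Γ))ᗮ).toLinearMap ≤
      (LinearMap.ker (EuclideanSpace.proj (𝕜 := 𝕜) (ι := Fin (insert i (Ω \ Γ)).card) i0).toLinearMap).map
        (Matrix.toEuclideanLin (ndotMat Φ Γ (insert i (Ω \ Γ)))) := by
  rintro _ ⟨s, hs, rfl⟩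
  obtain ⟨z, rfl⟩ := hS hs
  have h1 : Matrix.toEuclideanLin (colSub Φ Ω * rowSub X₀ Ω) z =
      Matrix.toEuclideanLin (colSub Φ Ω) (Matrix.toEuclideanLin (rowSub X₀ Ω) z) := by
    simp [Matrix.toLpLin_apply, Matrix.mulVec_mulVec]
  rw [h1, aux_toLin_apply, map_sum]
  refine Submodule.sum_mem _ fun j _ => ?_
  rw [map_smul]
  refine Submodule.smul_mem _ _ ?_
  have h2 : col (colSub Φ Ω) j = col Φ (Ω.orderEmbOfFin rfl j) := rfl
  rw [h2]
  have ha : Ω.orderEmbOfFin rfl j ∈ Ω := Finset.orderEmbOfFin_mem _ _ _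
  generalize Ω.orderEmbOfFin rfl j = a at ha
  change proj (mrange (colSub Φ Γ))ᗮ (col Φ a) ∈ _
  by_cases haΓ : a ∈ Γ
  · rw [aux_proj_col_zero Φ Γ haΓ]; exact Submodule.zero_mem _
  · rw [aux_proj_col]
    refine Submodule.smul_mem _ _ ?_
    obtain ⟨b, hb⟩ := aux_emb (insert i (Ω \ Γ)) (a := a) (by simp [ha, haΓ])
    refine ⟨EuclideanSpace.single b 1, ?_, ?_⟩
    · have : i0 ≠ b := by
        rintro rfl
        exact hi (by rw [← hi0, hb]; exact ha)
      simp [this]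
    · rw [aux_toLin_single, aux_col_ndotMat, hb]

/-- For each off-support index `i`, the norm of the
projection of `φ̇_i` onto the projected signal subspace is at most
`√(1 − σ²_{|{i} ∪ Ω \ Γ|}(Φ̇_{{i} ∪ Ω \ Γ}))`. -/
theorem statement12 {m n l k r : ℕ} (Φ : Matrix (Fin m) (Fin n) 𝕜)
    (X₀ : Matrix (Fin n) (Fin l) 𝕜) (Ω Γ : Finset (Fin n))
    (hΩ : rowSupport X₀ = Ω) (hk : Ω.card ≤ k)
    (Sbar : Submodule 𝕜 (EuclideanSpace 𝕜 (Fin m)))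
    (hS : Sbar ≤ mrange (colSub Φ Ω * rowSub X₀ Ω))
    (hr : Module.finrank 𝕜 Sbar = r) :
    ∀ i, i ∉ Ω ∪ Γ →
      ‖proj (Sbar.map (proj (mrange (colSub Φ Γ))ᗮ).toLinearMap) (ndot Φ Γ i)‖ ≤
        Real.sqrt (1 -
          sval (ndotMat Φ Γ (insert i (Ω \ Γ))) (insert i (Ω \ Γ)).card ^ 2) := by
  intro i hi
  have hiΩ : i ∉ Ω := fun h => hi (Finset.mem_union_left _ h)
  obtain ⟨i0, hi0⟩ := aux_emb (insert i (Ω \ Γ)) (Finset.mem_insert_self i _)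
  have hmem := aux_mem Φ X₀ Ω Γ Sbar hS i hiΩ i0 hi0
  generalize Sbar.map (proj (mrange (colSub Φ Γ))ᗮ).toLinearMap = W at hmem ⊢
  have hn := aux_norm_ndot_le Φ Γ i
  have hcol := aux_col_ndotMat Φ Γ (insert i (Ω \ Γ)) i0
  rw [hi0] at hcol
  generalize ndotMat Φ Γ (insert i (Ω \ Γ)) = A at hmem hcol ⊢
  generalize ndot Φ Γ i = v at hn hcol ⊢
  have hpv : proj W v ∈ W := (W.orthogonalProjectionOnto v).2
  have hpyth : ‖v‖ ^ 2 = ‖proj W v‖ ^ 2 + ‖v - proj W v‖ ^ 2 := by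
    have h0 : inner 𝕜 (proj W v) (v - proj W v) = 0 :=
      Submodule.inner_right_of_mem_orthogonal hpv
        (W.sub_starProjection_mem_orthogonal v)
    have := norm_add_sq_eq_norm_sq_add_norm_sq_of_inner_eq_zero (𝕜 := 𝕜) _ _ h0
    rw [add_sub_cancel] at this
    nlinarith [this]
  obtain ⟨c, hc, hcv⟩ := hmem hpv
  have hc0 : c i0 = 0 := by simpa using hc
  have hkey : ∀ t : ℝ, 0 ≤ t → (∃ S : Submodule 𝕜
      (EuclideanSpace 𝕜 (Fin (insert i (Ω \ Γ)).card)),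
      Module.finrank 𝕜 S = (insert i (Ω \ Γ)).card ∧
      ∀ x ∈ S, t * ‖x‖ ≤ ‖Matrix.toEuclideanLin A x‖) → t ≤ ‖v - proj W v‖ := by
    rintro t ht ⟨S, hSr, hSx⟩
    have hST : S = ⊤ := by
      apply Submodule.eq_top_of_finrank_eq
      rw [hSr, finrank_euclideanSpace_fin]
    have h1 := hSx (EuclideanSpace.single i0 1 - c) (by rw [hST]; trivial)
    rw [map_sub, aux_toLin_single, hcol, hcv] at h1
    have h2 : 1 ≤ ‖EuclideanSpace.single i0 (1 : 𝕜) - c‖ := by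
      have := PiLp.norm_apply_le (EuclideanSpace.single i0 (1 : 𝕜) - c) i0
      simpa [hc0] using this
    nlinarith
  have hs : sval A (insert i (Ω \ Γ)).card ≤ ‖v - proj W v‖ :=
    Real.sSup_le (fun t ht => hkey t ht.1 ht.2) (norm_nonneg _)
  have hs0 : 0 ≤ sval A (insert i (Ω \ Γ)).card :=
    Real.sSup_nonneg fun t ht => ht.1
  apply Real.le_sqrt_of_sq_le
  nlinarith [norm_nonneg v]

end
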